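/- If Π̇ is an open set of stationary policies, then the discounted visit-count map F is injective on Π̇; that is, if π, π' ∈ Π̇ and F(π) = F(π'), then π = π'. -/

import Mathlib

open scoped BigOperators

/-- A rewardless MDP with finite state and action spaces: transition kernel `T`,
initial distribution `I`, and discount factor `γ ∈ (0,1)`. -/
structure MDPnr (S A : Type) [Fintype S] [Fintype A] where
  T : S → A → S → ℝ
  T_nonneg : ∀ s a s', 0 ≤ T s a s'
  T_sum : ∀ s a, ∑ s', T s a s' = 1
  I : S → ℝ
  I_nonneg : ∀ s, 0 ≤ I s
  I_sum : ∑ s, I s = 1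
  γ : ℝ
  γ_pos : 0 < γ
  γ_lt_one : γ < 1

variable {S A : Type} [Fintype S] [Fintype A]

/-- A stationary policy: a distribution over actions in each state. -/
def IsPolicy (π : S → A → ℝ) : Prop :=
  (∀ s a, 0 ≤ π s a) ∧ ∀ s, ∑ a, π s a = 1

/-- The set of all stationary policies. -/
def allPolicies (S A : Type) [Fintype S] [Fintype A] : Set (S → A → ℝ) :=
  {π | IsPolicy π}

/-- The distribution over states at time `t` induced by policy `π`. -/
def stateDist (M : MDPnr S A) (π : S → A → ℝ) : ℕ → S → ℝ
  | 0 => M.I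
  | t + 1 => fun s' => ∑ s, ∑ a, stateDist M π t s * π s a * M.T s a s'

/-- Discounted state-action visit counts `F(π)(s,a) = ∑ₜ γᵗ P(Sₜ = s, Aₜ = a)`. -/
noncomputable def visit (M : MDPnr S A) (π : S → A → ℝ) : S → A → ℝ :=
  fun s a => ∑' t : ℕ, M.γ ^ t * stateDist M π t s * π s a

/-- The visit counts viewed as a vector in `ℝ^{S×A}`. -/
noncomputable def Fvec (M : MDPnr S A) (π : S → A → ℝ) : S × A → ℝ :=
  fun p => visit M π p.1 p.2

/-- The value `J_R(π) = ∑_{s,a} R(s,a) F(π)(s,a)` of a policy `π` under reward `R`. -/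
noncomputable def Jval (M : MDPnr S A) (R : S → A → ℝ) (π : S → A → ℝ) : ℝ :=
  ∑ s, ∑ a, R s a * visit M π s a

/-- `R₁, R₂` are unhackable on policy set `P` if no pair of policies is ordered
oppositely by the two reward functions. -/
def Unhackable (M : MDPnr S A) (P : Set (S → A → ℝ)) (R₁ R₂ : S → A → ℝ) : Prop :=
  ¬ ∃ π ∈ P, ∃ π' ∈ P, Jval M R₁ π < Jval M R₁ π' ∧ Jval M R₂ π > Jval M R₂ π'

/-- `R₁, R₂` are equivalent on `P` if they induce the same preference ordering. -/
def EquivalentOn (M : MDPnr S A) (P : Set (S → A → ℝ)) (R₁ R₂ : S → A → ℝ) : Prop :=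
  ∀ π ∈ P, ∀ π' ∈ P, (Jval M R₁ π ≤ Jval M R₁ π' ↔ Jval M R₂ π ≤ Jval M R₂ π')

/-- `R` is trivial on `P` if its value function is constant on `P`. -/
def TrivialOn (M : MDPnr S A) (P : Set (S → A → ℝ)) (R : S → A → ℝ) : Prop :=
  ∀ π ∈ P, ∀ π' ∈ P, Jval M R π = Jval M R π'

/-- The embedding `G(π)(s,a) = π(a|s)` of policies into `ℝ^{S×A}`. -/
def Gmap (π : S → A → ℝ) : S × A → ℝ := fun p => π p.1 p.2

/-- A set of stationary policies is open if its image under `G` is open in the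
smallest affine subspace of `ℝ^{S×A}` containing the `G`-image of all policies. -/
def OpenPolicySet (Pd : Set (S → A → ℝ)) : Prop :=
  Pd ⊆ allPolicies S A ∧
  IsOpen {x : (affineSpan ℝ (Gmap '' allPolicies S A) : Set (S × A → ℝ)) |
    (x : S × A → ℝ) ∈ Gmap '' Pd}

/-- Every state is reachable (with positive probability) under some policy. -/
def AllReachable (M : MDPnr S A) : Prop :=
  ∀ s : S, ∃ π : S → A → ℝ, IsPolicy π ∧ ∃ t : ℕ, 0 < stateDist M π t s

/-- `R₂` is a simplification of `R₁` relative to `P`. -/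
def Simplification (M : MDPnr S A) (P : Set (S → A → ℝ)) (R₁ R₂ : S → A → ℝ) : Prop :=
  (∀ π ∈ P, ∀ π' ∈ P,
    (Jval M R₁ π < Jval M R₁ π' → Jval M R₂ π ≤ Jval M R₂ π') ∧
    (Jval M R₁ π = Jval M R₁ π' → Jval M R₂ π = Jval M R₂ π')) ∧
  ∃ π ∈ P, ∃ π' ∈ P, Jval M R₂ π = Jval M R₂ π' ∧ Jval M R₁ π ≠ Jval M R₁ π'

lemma OpenPolicySet.pos {Pd : Set (S → A → ℝ)} (hopen : OpenPolicySet Pd)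
    {π : S → A → ℝ} (hπ : π ∈ Pd) (s : S) (a : A) : 0 < π s a := by
  classical
  have hp : IsPolicy π := hopen.1 hπ
  refine lt_of_le_of_ne (hp.1 s a) fun h0 => ?_
  set ρ : S → A → ℝ := Function.update π s (Pi.single a 1) with hρ
  have hρs : ρ s a = 1 := by simp [hρ]
  have hρp : IsPolicy ρ := by
    refine ⟨fun t b => ?_, fun t => ?_⟩
    · by_cases ht : t = s
      · subst ht
        by_cases hb : b = a
        · subst hb; simp [hρ]
        · simp [hρ, hb]
      · simpa [hρ, ht] using hp.1 t b
    · by_cases ht : t = s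
      · subst ht; simp [hρ]
      · simpa [hρ, ht] using hp.2 t
  have hmem : ∀ c : ℝ, AffineMap.lineMap (Gmap π) (Gmap ρ) c ∈
      (affineSpan ℝ (Gmap '' allPolicies S A) : Set (S × A → ℝ)) := fun c =>
    AffineMap.lineMap_mem c (subset_affineSpan ℝ _ ⟨π, hp, rfl⟩)
      (subset_affineSpan ℝ _ ⟨ρ, hρp, rfl⟩)
  have hcont : Continuous fun c : ℝ =>
      (⟨AffineMap.lineMap (Gmap π) (Gmap ρ) c, hmem c⟩ :
        (affineSpan ℝ (Gmap '' allPolicies S A) : Set (S × A → ℝ))) :=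
    AffineMap.lineMap_continuous.subtype_mk _
  have hnhds := (hopen.2.preimage hcont).mem_nhds
    (show (0 : ℝ) ∈ _ from ⟨π, hπ, by simp⟩)
  obtain ⟨c, ⟨σ, hσ, hσc⟩, hc⟩ :=
    ((mem_nhdsWithin_of_mem_nhds hnhds : _ ∈ nhdsWithin (0 : ℝ) (Set.Iio 0)) |>
      Filter.Eventually.and <| self_mem_nhdsWithin).exists
  have hval : σ s a = c := by
    have := congrFun hσc (s, a)
    simpa [Gmap, AffineMap.lineMap_apply, hρs, ← h0] using this
  exact absurd ((hopen.1 hσ).1 s a) (by rw [hval]; exact not_le.2 hc)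

lemma stateDist_nonneg (M : MDPnr S A) {π : S → A → ℝ} (hπ : IsPolicy π) (t : ℕ) (s : S) :
    0 ≤ stateDist M π t s := by
  induction t generalizing s with
  | zero => exact M.I_nonneg s
  | succ t ih =>
    exact Finset.sum_nonneg fun x _ => Finset.sum_nonneg fun a _ =>
      mul_nonneg (mul_nonneg (ih x) (hπ.1 x a)) (M.T_nonneg x a s)

lemma sum_stateDist (M : MDPnr S A) {π : S → A → ℝ} (hπ : IsPolicy π) (t : ℕ) :
    ∑ s, stateDist M π t s = 1 := by
  induction t with
  | zero => exact M.I_sum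
  | succ t ih =>
    simp only [stateDist]
    rw [Finset.sum_comm]
    refine Eq.trans (Finset.sum_congr rfl fun x _ => ?_) ih
    rw [Finset.sum_comm]
    simp only [← Finset.mul_sum, M.T_sum, mul_one, hπ.2 x]

lemma stateDist_le_one (M : MDPnr S A) {π : S → A → ℝ} (hπ : IsPolicy π) (t : ℕ) (s : S) :
    stateDist M π t s ≤ 1 :=
  sum_stateDist M hπ t ▸
    Finset.single_le_sum (fun x _ => stateDist_nonneg M hπ t x) (Finset.mem_univ s)

lemma summable_discounted_stateDist (M : MDPnr S A) {π : S → A → ℝ} (hπ : IsPolicy π) (s : S) :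
    Summable fun t : ℕ => M.γ ^ t * stateDist M π t s :=
  (summable_geometric_of_lt_one M.γ_pos.le M.γ_lt_one).of_nonneg_of_le
    (fun t => mul_nonneg (pow_nonneg M.γ_pos.le t) (stateDist_nonneg M hπ t s))
    fun t => mul_le_of_le_one_right (pow_nonneg M.γ_pos.le t) (stateDist_le_one M hπ t s)

/-- A policy taking every action with positive probability reaches, at every time, each state
that some other policy reaches at that time. -/
lemma stateDist_pos_of_pos (M : MDPnr S A) {π ρ : S → A → ℝ} (hπ : IsPolicy π)
    (hpos : ∀ s a, 0 < π s a) (hρ : IsPolicy ρ) {t : ℕ} {s : S}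
    (h : 0 < stateDist M ρ t s) : 0 < stateDist M π t s := by
  induction t generalizing s with
  | zero => exact h
  | succ t ih =>
    obtain ⟨x, -, hx⟩ := Finset.exists_ne_zero_of_sum_ne_zero h.ne'
    obtain ⟨a, -, ha⟩ := Finset.exists_ne_zero_of_sum_ne_zero hx
    have hT : 0 < M.T x a s := (M.T_nonneg x a s).lt_of_ne' (right_ne_zero_of_mul ha)
    have hd : 0 < stateDist M ρ t x :=
      (stateDist_nonneg M hρ t x).lt_of_ne' (left_ne_zero_of_mul (left_ne_zero_of_mul ha))
    have hnn : ∀ y b, 0 ≤ stateDist M π t y * π y b * M.T y b s := fun y b =>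
      mul_nonneg (mul_nonneg (stateDist_nonneg M hπ t y) (hπ.1 y b)) (M.T_nonneg y b s)
    exact Finset.sum_pos' (fun y _ => Finset.sum_nonneg fun b _ => hnn y b)
      ⟨x, Finset.mem_univ x, Finset.sum_pos' (fun b _ => hnn x b)
        ⟨a, Finset.mem_univ a, mul_pos (mul_pos (ih hd) (hpos x a)) hT⟩⟩

lemma visit_eq_mul (M : MDPnr S A) (π : S → A → ℝ) (s : S) (a : A) :
    visit M π s a = (∑' t : ℕ, M.γ ^ t * stateDist M π t s) * π s a :=
  tsum_mul_right

lemma sum_visit (M : MDPnr S A) {π : S → A → ℝ} (hπ : IsPolicy π) (s : S) :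
    ∑ a, visit M π s a = ∑' t : ℕ, M.γ ^ t * stateDist M π t s := by
  simp only [visit_eq_mul, ← Finset.mul_sum, hπ.2 s, mul_one]

/-- The discounted visit-count map is injective on any open set of
stationary policies. -/
theorem visit_injective_on_open
    (M : MDPnr S A) (hA : 1 < Fintype.card A) (hreach : AllReachable M)
    (Pd : Set (S → A → ℝ)) (hopen : OpenPolicySet Pd)
    (π π' : S → A → ℝ) (hπ : π ∈ Pd) (hπ' : π' ∈ Pd)
    (h : visit M π = visit M π') : π = π' := by
  have hp : IsPolicy π := hopen.1 hπ
  have hp' : IsPolicy π' := hopen.1 hπ'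
  funext s a
  obtain ⟨ρ, hρ, t, ht⟩ := hreach s
  have hw : 0 < ∑' t : ℕ, M.γ ^ t * stateDist M π t s :=
    (summable_discounted_stateDist M hp s).tsum_pos
      (fun t => mul_nonneg (pow_nonneg M.γ_pos.le t) (stateDist_nonneg M hp t s)) t
      (mul_pos (pow_pos M.γ_pos t) (stateDist_pos_of_pos M hp (fun _ _ => hopen.pos hπ _ _) hρ ht))
  refine mul_left_cancel₀ hw.ne' ?_
  rw [← visit_eq_mul, h, visit_eq_mul, ← sum_visit M hp', ← sum_visit M hp, h]
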